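/- The smallest subfield of ℂ containing all the values S_{χ₁,χ₂}(γ) for γ ∈ Γ₀(q₁q₂) is exactly F_{χ₁,χ₂}, the smallest subfield of ℂ containing all values of χ₁ and χ₂. -/

import Mathlib

open scoped BigOperators

/-- The sawtooth (first Bernoulli) function `B₁`. -/
noncomputable def sawtooth (x : ℝ) : ℝ :=
  open scoped Classical in
  if ∃ n : ℤ, x = (n : ℝ) then 0 else x - ⌊x⌋ - 1 / 2

/-- The newform Dedekind sum `S_{χ₁,χ₂}(h,k)`. -/
noncomputable def newformDedekindSum {q₁ q₂ : ℕ} (χ₁ : DirichletCharacter ℂ q₁)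
    (χ₂ : DirichletCharacter ℂ q₂) (h k : ℤ) : ℂ :=
  ∑ j ∈ Finset.range k.toNat, ∑ n ∈ Finset.range q₁,
    (starRingEnd ℂ) (χ₂ (j : ZMod q₂)) * (starRingEnd ℂ) (χ₁ (n : ZMod q₁)) *
      (sawtooth ((j : ℝ) / (k : ℝ)) : ℝ) *
      (sawtooth ((n : ℝ) / (q₁ : ℝ) + (h : ℝ) * (j : ℝ) / (k : ℝ)) : ℝ)

/-- The newform Dedekind sum of a matrix `γ`, via its left column. -/
noncomputable def SGamma {q₁ q₂ : ℕ} (χ₁ : DirichletCharacter ℂ q₁)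
    (χ₂ : DirichletCharacter ℂ q₂) (γ : Matrix.SpecialLinearGroup (Fin 2) ℤ) : ℂ :=
  if 0 < (γ : Matrix (Fin 2) (Fin 2) ℤ) 1 0 then
    newformDedekindSum χ₁ χ₂ ((γ : Matrix (Fin 2) (Fin 2) ℤ) 0 0)
      ((γ : Matrix (Fin 2) (Fin 2) ℤ) 1 0)
  else if (γ : Matrix (Fin 2) (Fin 2) ℤ) 1 0 < 0 then
    newformDedekindSum χ₁ χ₂ (-(γ : Matrix (Fin 2) (Fin 2) ℤ) 0 0)
      (-(γ : Matrix (Fin 2) (Fin 2) ℤ) 1 0)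
  else 0

/-- `F_{χ₁,χ₂}`, the smallest subfield of `ℂ` containing all values of `χ₁` and `χ₂`. -/
noncomputable def Ffield {q₁ q₂ : ℕ} (χ₁ : DirichletCharacter ℂ q₁) (χ₂ : DirichletCharacter ℂ q₂) :
    Subfield ℂ :=
  Subfield.closure (Set.range χ₁ ∪ Set.range χ₂)


open Finset

/-- Splitting a sum over `range (a * b)` into blocks of length `b`. -/
lemma sum_range_mul_eq_sum_sum (f : ℕ → ℂ) (a b : ℕ) :
    ∑ j ∈ range (a * b), f j = ∑ r ∈ range b, ∑ s ∈ range a, f (b * s + r) := by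
  rw [sum_comm]
  induction a with
  | zero => simp
  | succ a ih => rw [Nat.succ_mul, sum_range_add, ih, sum_range_succ, mul_comm a b]

/-- The sum of a `b`-periodic function over a full period does not depend on the starting point. -/
lemma sum_range_add_eq_of_periodic {f : ℕ → ℂ} {b : ℕ} (hf : Function.Periodic f b) (m : ℕ) :
    ∑ s ∈ range b, f (m + s) = ∑ s ∈ range b, f s := by
  induction m with
  | zero => simp
  | succ m ih =>
    rw [← ih]
    have h₁ := sum_range_succ (fun s ↦ f (m + s)) b
    have h₂ := sum_range_succ' (fun s ↦ f (m + s)) b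
    simp only [hf m, add_zero, ← add_assoc, add_right_comm m _ 1] at h₁ h₂
    exact add_right_cancel (h₂.symm.trans h₁)

/-- Sum of a function of residues over several full periods. -/
lemma sum_range_natCast_zmod {q : ℕ} [NeZero q] (F : ZMod q → ℂ) :
    ∑ n ∈ range q, F n = ∑ x, F x := by
  refine sum_nbij' (fun n ↦ (n : ZMod q)) ZMod.val ?_ ?_ ?_ ?_ ?_
  · simp
  · simp [ZMod.val_lt]
  · intro n hn
    exact ZMod.val_cast_of_lt (mem_range.mp hn)
  · simp
  · simp

lemma two_mul_sum_range_cast (n : ℕ) : 2 * ∑ i ∈ range n, (i : ℂ) = n * (n - 1) := by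
  induction n with
  | zero => simp
  | succ n ih => rw [sum_range_succ, mul_add, ih]; push_cast; ring

/-- The function `m ↦ b² (B̃₂(m / b) - 1 / 6)`, where `B̃₂` is the periodic second Bernoulli
function. -/
noncomputable def modQuad (b m : ℕ) : ℂ := ((m % b : ℕ) : ℂ) ^ 2 - b * ((m % b : ℕ) : ℂ)

lemma modQuad_periodic (b : ℕ) : Function.Periodic (modQuad b) b := by
  intro m; simp [modQuad]

lemma modQuad_eq_of_modEq {b m n : ℕ} (h : m ≡ n [MOD b]) : modQuad b m = modQuad b n := by
  have : m % b = n % b := h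
  simp [modQuad, this]

lemma modQuad_succ_sub {b : ℕ} (hb : 0 < b) (m : ℕ) :
    modQuad b (m + 1) - modQuad b m = 2 * ((m % b : ℕ) : ℂ) + 1 - b := by
  unfold modQuad
  have hlt := Nat.mod_lt m hb
  rcases eq_or_ne (m % b + 1) b with h | h
  · have h' : (m + 1) % b = 0 := by rw [← Nat.mod_add_mod, h, Nat.mod_self]
    have hc : (b : ℂ) = ((m % b : ℕ) : ℂ) + 1 := by exact_mod_cast h.symm
    rw [h', hc]; push_cast; ring
  · have h' : (m + 1) % b = m % b + 1 := by
      rw [← Nat.mod_add_mod, Nat.mod_eq_of_lt (by omega)]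
    rw [h']; push_cast; ring

/-- The cyclic correlation of the residue function with itself is quadratic. -/
lemma two_mul_sum_mul_mod {b : ℕ} (hb : 0 < b) (m : ℕ) :
    2 * ∑ s ∈ range b, (s : ℂ) * (((m + s) % b : ℕ) : ℂ) =
      2 * ∑ s ∈ range b, (s : ℂ) * ((s % b : ℕ) : ℂ) + b * modQuad b m := by
  induction m with
  | zero => simp [modQuad]
  | succ m ih =>
    have hper : Function.Periodic (fun s : ℕ ↦ ((s % b : ℕ) : ℂ)) b := by intro s; simp
    have hW : 2 * ∑ s ∈ range b, (((m + 1 + s) % b : ℕ) : ℂ) = b * (b - 1) := by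
      rw [sum_range_add_eq_of_periodic hper (m + 1), ← two_mul_sum_range_cast]
      congr 1
      exact sum_congr rfl fun s hs ↦ by rw [Nat.mod_eq_of_lt (mem_range.mp hs)]
    have h₁ := sum_range_succ (fun s : ℕ ↦ (s : ℂ) * (((m + s) % b : ℕ) : ℂ)) b
    have h₂ := sum_range_succ' (fun s : ℕ ↦ (s : ℂ) * (((m + s) % b : ℕ) : ℂ)) b
    simp only [Nat.cast_add, Nat.cast_one, add_mul, one_mul, sum_add_distrib, Nat.cast_zero,
      zero_mul, add_zero, Nat.add_mod_right, ← add_assoc, add_right_comm m _ 1] at h₁ h₂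
    have h₃ := modQuad_succ_sub hb m
    linear_combination ih + 2 * h₁ - 2 * h₂ - hW - b * h₃

/-- Distribution relation for `modQuad`. -/
lemma exists_sum_modQuad_eq (c e : ℕ) {D : ℕ} (hD : 0 < D) :
    ∃ κ : ℂ, ∀ m, ∑ i ∈ range (e * c), modQuad (D * c) (m + D * i) =
      e * (c * modQuad D m) + κ := by
  refine ⟨e * ∑ i ∈ range c, (((D : ℂ) * i) ^ 2 - D * c * (D * i)), fun m ↦ ?_⟩
  have hper : ∀ m, Function.Periodic (fun i ↦ modQuad (D * c) (m + D * i)) c := by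
    intro m i
    simp only [mul_add, ← add_assoc]
    exact modQuad_periodic _ _
  have hblock : ∑ i ∈ range (e * c), modQuad (D * c) (m + D * i) =
      e * ∑ i ∈ range c, modQuad (D * c) (m + D * i) := by
    rw [sum_range_mul_eq_sum_sum, mul_sum]
    refine sum_congr rfl fun i _ ↦ ?_
    have : ∀ s, modQuad (D * c) (m + D * (c * s + i)) = modQuad (D * c) (m + D * i) := fun s ↦
      modQuad_eq_of_modEq (by
        rw [show m + D * (c * s + i) = m + D * i + D * c * s by ring]
        exact Nat.add_mul_mod_self_left _ _ _)
    simp [this]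
  have hred : ∑ i ∈ range c, modQuad (D * c) (m + D * i) =
      ∑ i ∈ range c, modQuad (D * c) (m % D + D * i) := by
    rw [← sum_range_add_eq_of_periodic (hper (m % D)) (m / D)]
    refine sum_congr rfl fun i _ ↦ ?_
    rw [mul_add, ← add_assoc, Nat.mod_add_div]
  have hval : ∑ i ∈ range c, modQuad (D * c) (m % D + D * i) =
      c * modQuad D m + ∑ i ∈ range c, (((D : ℂ) * i) ^ 2 - D * c * (D * i)) := by
    have h : ∀ i ∈ range c, modQuad (D * c) (m % D + D * i) =
        (((m % D : ℕ) : ℂ) ^ 2 - D * c * ((m % D : ℕ) : ℂ)) +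
          ((m % D : ℕ) : ℂ) * D * (2 * i) + (((D : ℂ) * i) ^ 2 - D * c * (D * i)) := by
      intro i hi
      have hlt : m % D + D * i < D * c := by
        have := Nat.mod_lt m hD
        have := Nat.mul_le_mul_left D (Nat.succ_le_of_lt (mem_range.mp hi))
        rw [Nat.succ_eq_add_one, mul_add] at this
        omega
      rw [modQuad, Nat.mod_eq_of_lt hlt]
      push_cast; ring
    rw [sum_congr rfl h, sum_add_distrib, sum_add_distrib, ← mul_sum, ← mul_sum,
      two_mul_sum_range_cast, modQuad]
    simp only [sum_const, card_range, nsmul_eq_mul]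
    ring
  rw [hblock, hred, hval]
  ring

/-- `modQuad` of a linear form depends only on residues. -/
lemma modQuad_linear_eq {q₁ q₂ : ℕ} [NeZero q₁] [NeZero q₂] (n r : ℕ) :
    modQuad (q₁ * q₂) (q₂ * n + q₁ * r) =
      modQuad (q₁ * q₂) (q₂ * (n : ZMod q₁).val + q₁ * (r : ZMod q₂).val) := by
  refine modQuad_eq_of_modEq (Nat.ModEq.add ?_ ?_)
  · rw [mul_comm q₁, ZMod.val_natCast]
    exact ((Nat.mod_modEq _ _).mul_left' q₂).symm
  · rw [ZMod.val_natCast]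
    exact ((Nat.mod_modEq _ _).mul_left' q₁).symm

lemma sawtooth_int_add {x : ℝ} (hx₀ : 0 < x) (hx₁ : x < 1) (k : ℤ) :
    sawtooth (k + x) = x - 1 / 2 := by
  have hfl : ⌊x⌋ = 0 := Int.floor_eq_zero_iff.mpr ⟨hx₀.le, hx₁⟩
  have hne : ¬ ∃ n : ℤ, (k + x : ℝ) = n := by
    rintro ⟨n, hn⟩
    have h : x = ((n - k : ℤ) : ℝ) := by push_cast; linarith
    rw [h] at hx₀ hx₁
    have h₀ : (0 : ℤ) < n - k := by exact_mod_cast hx₀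
    have h₁ : n - k < (1 : ℤ) := by exact_mod_cast hx₁
    omega
  rw [sawtooth, if_neg hne, Int.floor_intCast_add, hfl]
  push_cast; ring

lemma sawtooth_div_add {b r : ℕ} (hr₀ : 0 < r) (hrb : r < b) (M : ℕ) :
    sawtooth ((M : ℝ) / b + (r : ℝ) / (b : ℝ) ^ 2) =
      ((M % b : ℕ) : ℝ) / b + (r : ℝ) / (b : ℝ) ^ 2 - 1 / 2 := by
  have hb : (0 : ℝ) < b := by exact_mod_cast hr₀.trans hrb
  have hM : (M : ℝ) / b = ((M / b : ℕ) : ℤ) + ((M % b : ℕ) : ℝ) / b := by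
    have : (M : ℝ) = b * (M / b : ℕ) + (M % b : ℕ) := by exact_mod_cast (Nat.div_add_mod M b).symm
    rw [Int.cast_natCast]
    field_simp
    linarith
  rw [hM, add_assoc]
  have hr : (0 : ℝ) < r := by exact_mod_cast hr₀
  refine sawtooth_int_add (by positivity) ?_ _
  have h₁ : ((M % b : ℕ) : ℝ) + 1 ≤ b := by exact_mod_cast Nat.mod_lt M (hr₀.trans hrb)
  have h₂ : (r : ℝ) < b := by exact_mod_cast hrb
  have h₃ : (r : ℝ) / (b : ℝ) ^ 2 < 1 / b := by
    rw [div_lt_div_iff₀ (by positivity) hb]; nlinarith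
  calc ((M % b : ℕ) : ℝ) / b + (r : ℝ) / (b : ℝ) ^ 2 < ((M % b : ℕ) : ℝ) / b + 1 / b := by linarith
    _ ≤ 1 := by rw [← add_div, div_le_one hb]; exact h₁

lemma ne_one_of_isPrimitive {q : ℕ} (hq : 1 < q) {χ : DirichletCharacter ℂ q}
    (hχ : χ.IsPrimitive) : χ ≠ 1 := by
  rintro rfl
  have : NeZero q := ⟨by omega⟩
  rw [DirichletCharacter.isPrimitive_def, DirichletCharacter.conductor_one] at hχ
  omega

/-- For a product of shifted sawtooth values summed over a residue class, only the quadratic part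
depends on the shift. -/
lemma exists_sum_sawtooth_mul_eq {b r : ℕ} (hr₀ : 0 < r) (hrb : r < b) :
    ∃ κ : ℂ, ∀ m : ℕ,
      ∑ s ∈ range b, ((sawtooth ((s : ℝ) / b + (r : ℝ) / (b : ℝ) ^ 2) : ℝ) : ℂ) *
        ((sawtooth (((m + s : ℕ) : ℝ) / b + (r : ℝ) / (b : ℝ) ^ 2) : ℝ) : ℂ) =
      modQuad b m / (2 * b) + κ := by
  have hb : 0 < b := hr₀.trans hrb
  have hb' : (b : ℂ) ≠ 0 := by exact_mod_cast hb.ne'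
  set ρ : ℂ := (r : ℂ) / (b : ℂ) ^ 2 - 1 / 2 with hρ
  refine ⟨(∑ s ∈ range b, (s : ℂ) * ((s % b : ℕ) : ℂ)) / b ^ 2
    + (∑ s ∈ range b, (s : ℂ)) / b * ρ + (∑ s ∈ range b, ((s % b : ℕ) : ℂ)) / b * ρ + b * ρ ^ 2,
    fun m ↦ ?_⟩
  have hper : Function.Periodic (fun s : ℕ ↦ ((s % b : ℕ) : ℂ)) b := by intro s; simp
  have hterm : ∀ s ∈ range b,
      ((sawtooth ((s : ℝ) / b + (r : ℝ) / (b : ℝ) ^ 2) : ℝ) : ℂ) *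
        ((sawtooth (((m + s : ℕ) : ℝ) / b + (r : ℝ) / (b : ℝ) ^ 2) : ℝ) : ℂ) =
      (s : ℂ) * (((m + s) % b : ℕ) : ℂ) * (1 / b ^ 2) + (s : ℂ) * (ρ / b)
        + (((m + s) % b : ℕ) : ℂ) * (ρ / b) + ρ ^ 2 := by
    intro s hs
    rw [sawtooth_div_add hr₀ hrb, sawtooth_div_add hr₀ hrb, Nat.mod_eq_of_lt (mem_range.mp hs), hρ]
    push_cast
    ring
  have hW := sum_range_add_eq_of_periodic hper m
  have hG := two_mul_sum_mul_mod hb m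
  rw [sum_congr rfl hterm, sum_add_distrib, sum_add_distrib, sum_add_distrib, ← sum_mul,
    ← sum_mul, ← sum_mul, hW, sum_const, card_range, nsmul_eq_mul,
    show ∑ s ∈ range b, (s : ℂ) * (((m + s) % b : ℕ) : ℂ) =
      ∑ s ∈ range b, (s : ℂ) * ((s % b : ℕ) : ℂ) + b / 2 * modQuad b m by
        linear_combination hG / 2]
  field_simp
  ring

/-- Evaluation of the newform Dedekind sum attached to the left column of the parabolic matrix
`(1 + a b, -a²; b², 1 - a b)`. -/
lemma newformDedekindSum_parabolic {q₁ q₂ : ℕ} (hq₁ : 1 < q₁) (hq₂ : 1 < q₂)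
    (χ₁ : DirichletCharacter ℂ q₁) (χ₂ : DirichletCharacter ℂ q₂) (hχ₁ : χ₁.IsPrimitive)
    (a : ℕ) {b d : ℕ} (hb : 0 < b) (hbd : b = d * q₁) (hbq : q₂ ∣ b) :
    2 * b * newformDedekindSum χ₁ χ₂ (1 + a * b) (b ^ 2) =
      ∑ r ∈ range b, ∑ n ∈ range q₁, χ₂⁻¹ r * χ₁⁻¹ n * modQuad b (d * n + a * r) := by
  have : NeZero q₁ := ⟨by omega⟩
  have : Fact (1 < q₂) := ⟨hq₂⟩
  have hbC : (b : ℂ) ≠ 0 := by exact_mod_cast hb.ne'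
  have hbR : (b : ℝ) ≠ 0 := by exact_mod_cast hb.ne'
  have hq₁R : (q₁ : ℝ) ≠ 0 := by exact_mod_cast (NeZero.ne q₁)
  have hsum : ∑ n ∈ range q₁, χ₁⁻¹ (n : ZMod q₁) = 0 := by
    rw [sum_range_natCast_zmod (fun x ↦ χ₁⁻¹ x)]
    exact MulChar.sum_eq_zero_of_ne_one (inv_ne_one.mpr (ne_one_of_isPrimitive hq₁ hχ₁))
  have hconj₁ : ∀ x, (starRingEnd ℂ) (χ₁ x) = χ₁⁻¹ x := MulChar.star_apply' χ₁
  have hconj₂ : ∀ x, (starRingEnd ℂ) (χ₂ x) = χ₂⁻¹ x := MulChar.star_apply' χ₂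
  have hk : ((b : ℤ) ^ 2).toNat = b * b := by
    rw [← Nat.cast_pow, Int.toNat_natCast, sq]
  rw [newformDedekindSum, hk, sum_range_mul_eq_sum_sum, mul_sum]
  refine sum_congr rfl fun r hr ↦ ?_
  have hχ₂ : ∀ s : ℕ, χ₂⁻¹ ((b * s + r : ℕ) : ZMod q₂) = χ₂⁻¹ (r : ZMod q₂) := by
    intro s
    have : (b : ZMod q₂) = 0 := (ZMod.natCast_eq_zero_iff _ _).mpr hbq
    push_cast
    rw [this, zero_mul, zero_add]
  rcases Nat.eq_zero_or_pos r with rfl | hr₀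
  · have h0 : χ₂⁻¹ (0 : ZMod q₂) = 0 := MulChar.map_zero _
    simp only [hconj₂, hχ₂, Nat.cast_zero, h0, zero_mul, sum_const_zero, mul_zero]
  obtain ⟨κ, hκ⟩ := exists_sum_sawtooth_mul_eq hr₀ (mem_range.mp hr)
  rw [sum_comm]
  have hinner : ∀ n ∈ range q₁,
      ∑ s ∈ range b, (starRingEnd ℂ) (χ₂ ((b * s + r : ℕ) : ZMod q₂)) *
        (starRingEnd ℂ) (χ₁ (n : ZMod q₁)) *
        (sawtooth (((b * s + r : ℕ) : ℝ) / (((b : ℤ) ^ 2 : ℤ) : ℝ)) : ℝ) *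
        (sawtooth ((n : ℝ) / (q₁ : ℝ) + ((1 + a * b : ℤ) : ℝ) * ((b * s + r : ℕ) : ℝ) /
          (((b : ℤ) ^ 2 : ℤ) : ℝ)) : ℝ) =
      χ₂⁻¹ r * χ₁⁻¹ n * modQuad b (d * n + a * r) / (2 * b) + χ₂⁻¹ r * κ * χ₁⁻¹ n := by
    intro n _
    have harg₁ : ∀ s : ℕ, ((b * s + r : ℕ) : ℝ) / (((b : ℤ) ^ 2 : ℤ) : ℝ) =
        (s : ℝ) / b + (r : ℝ) / (b : ℝ) ^ 2 := by
      intro s; push_cast; field_simp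
    have harg₂ : ∀ s : ℕ, (n : ℝ) / (q₁ : ℝ) + ((1 + a * b : ℤ) : ℝ) * ((b * s + r : ℕ) : ℝ) /
          (((b : ℤ) ^ 2 : ℤ) : ℝ) =
        ((d * n + a * r + s + a * s * b : ℕ) : ℝ) / b + (r : ℝ) / (b : ℝ) ^ 2 := by
      intro s
      have hd : (d : ℝ) * q₁ = b := by exact_mod_cast hbd.symm
      have hn : (n : ℝ) / q₁ = d * n / b := by
        rw [← hd]
        have : (d : ℝ) ≠ 0 := by rintro h; rw [h, zero_mul] at hd; exact hbR hd.symm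
        field_simp
      rw [hn]
      push_cast; field_simp; ring
    have hsaw : ∀ s : ℕ,
        sawtooth (((d * n + a * r + s + a * s * b : ℕ) : ℝ) / b + (r : ℝ) / (b : ℝ) ^ 2) =
        sawtooth (((d * n + a * r + s : ℕ) : ℝ) / b + (r : ℝ) / (b : ℝ) ^ 2) := by
      intro s
      rw [sawtooth_div_add hr₀ (mem_range.mp hr), sawtooth_div_add hr₀ (mem_range.mp hr),
        Nat.add_mul_mod_self_right]
    simp only [hconj₁, hconj₂, hχ₂, harg₁, harg₂, hsaw]
    simp only [mul_assoc, ← mul_sum, hκ]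
    ring
  rw [sum_congr rfl hinner, sum_add_distrib, ← mul_sum, hsum, mul_zero, add_zero, mul_sum]
  refine sum_congr rfl fun n _ ↦ ?_
  field_simp

/-- The twisted second Bernoulli sum governing the parabolic values of the Dedekind sum. -/
noncomputable def twistedQuadSum {q₁ q₂ : ℕ} [NeZero q₁] [NeZero q₂]
    (χ₁ : DirichletCharacter ℂ q₁) (χ₂ : DirichletCharacter ℂ q₂) : ℂ :=
  ∑ x : ZMod q₂, ∑ y : ZMod q₁, χ₂ x * χ₁ y * modQuad (q₁ * q₂) (q₂ * y.val + q₁ * x.val)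

lemma sum_apply_mul_unit {q : ℕ} [NeZero q] (χ : DirichletCharacter ℂ q) (u : (ZMod q)ˣ)
    (F : ZMod q → ℂ) : ∑ x, χ⁻¹ x * F (u * x) = χ u * ∑ x, χ⁻¹ x * F x := by
  rw [← Equiv.sum_comp u.mulLeft (fun x ↦ χ⁻¹ x * F x), mul_sum]
  refine sum_congr rfl fun x _ ↦ ?_
  rw [Units.mulLeft_apply, map_mul χ⁻¹, MulChar.inv_apply_eq_inv' χ u, ← mul_assoc, ← mul_assoc,
    mul_inv_cancel₀ (IsUnit.ne_zero (u.isUnit.map χ)), one_mul]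

lemma sum_modQuad_numerator {q₁ q₂ : ℕ} [NeZero q₁] [NeZero q₂]
    (χ₁ : DirichletCharacter ℂ q₁) (χ₂ : DirichletCharacter ℂ q₂) (u : (ZMod q₂)ˣ) :
    ∑ r ∈ range (q₁ * q₂), ∑ n ∈ range q₁,
      χ₂⁻¹ r * χ₁⁻¹ n * modQuad (q₁ * q₂) (q₂ * n + (q₁ * (u : ZMod q₂).val : ℕ) * r) =
    q₁ * χ₂ u * twistedQuadSum χ₁⁻¹ χ₂⁻¹ := by
  let F : ZMod q₂ → ℂ := fun x ↦
    ∑ y : ZMod q₁, χ₁⁻¹ y * modQuad (q₁ * q₂) (q₂ * y.val + q₁ * x.val)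
  have hF : ∀ r : ℕ, ∑ n ∈ range q₁,
      χ₂⁻¹ r * χ₁⁻¹ n * modQuad (q₁ * q₂) (q₂ * n + (q₁ * (u : ZMod q₂).val : ℕ) * r) =
      χ₂⁻¹ r * F (u * r) := by
    intro r
    simp only [F, mul_sum, ← mul_assoc]
    rw [← sum_range_natCast_zmod]
    refine sum_congr rfl fun n _ ↦ ?_
    rw [mul_assoc q₁, modQuad_linear_eq]
    simp
  simp only [hF]
  rw [sum_range_mul_eq_sum_sum]
  simp only [Nat.cast_add, Nat.cast_mul, CharP.cast_eq_zero, zero_mul, zero_add, sum_const,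
    card_range, nsmul_eq_mul]
  rw [← mul_sum, sum_range_natCast_zmod (fun x ↦ χ₂⁻¹ x * F (u * x)), sum_apply_mul_unit,
    twistedQuadSum, ← mul_assoc]
  simp only [F, mul_sum, ← mul_assoc]

lemma sum_modQuad_denominator {q₁ q₂ : ℕ} [NeZero q₁] [NeZero q₂] (hq₁ : 1 < q₁)
    (χ₁ : DirichletCharacter ℂ q₁) (χ₂ : DirichletCharacter ℂ q₂) (hχ₁ : χ₁.IsPrimitive)
    (u : (ZMod q₁)ˣ) :
    ∑ r ∈ range (q₁ * q₂ * (u : ZMod q₁).val), ∑ n ∈ range q₁,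
      χ₂⁻¹ r * χ₁⁻¹ n *
        modQuad (q₁ * q₂ * (u : ZMod q₁).val) ((q₂ * (u : ZMod q₁).val : ℕ) * n + q₁ * r) =
    q₁ * (u : ZMod q₁).val * χ₁ u * twistedQuadSum χ₁⁻¹ χ₂⁻¹ := by
  set c := (u : ZMod q₁).val with hc
  have hsum : ∑ n ∈ range q₁, χ₁⁻¹ (n : ZMod q₁) = 0 := by
    rw [sum_range_natCast_zmod (fun x ↦ χ₁⁻¹ x)]
    exact MulChar.sum_eq_zero_of_ne_one (inv_ne_one.mpr (ne_one_of_isPrimitive hq₁ hχ₁))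
  obtain ⟨κ, hκ⟩ := exists_sum_modQuad_eq c q₁ (D := q₁ * q₂)
    (Nat.mul_pos (NeZero.pos q₁) (NeZero.pos q₂))
  let G : ZMod q₂ → ZMod q₁ → ℂ := fun x y ↦ modQuad (q₁ * q₂) (q₂ * y.val + q₁ * x.val)
  have hmain : ∀ r : ℕ, ∑ s ∈ range (q₁ * c), ∑ n ∈ range q₁,
      χ₂⁻¹ ((q₂ * s + r : ℕ) : ZMod q₂) * χ₁⁻¹ n *
        modQuad (q₁ * q₂ * c) ((q₂ * c : ℕ) * n + q₁ * (q₂ * s + r)) =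
      q₁ * c * χ₁ u * (χ₂⁻¹ r * ∑ y, χ₁⁻¹ y * G r y) := by
    intro r
    rw [sum_comm]
    have hn : ∀ n ∈ range q₁, ∑ s ∈ range (q₁ * c),
        χ₂⁻¹ ((q₂ * s + r : ℕ) : ZMod q₂) * χ₁⁻¹ n *
        modQuad (q₁ * q₂ * c) ((q₂ * c : ℕ) * n + q₁ * (q₂ * s + r)) =
        q₁ * c * χ₂⁻¹ r * (χ₁⁻¹ n * G r (u * n)) + χ₂⁻¹ r * κ * χ₁⁻¹ n := by
      intro n _
      have harg : ∀ s : ℕ, q₂ * c * n + q₁ * (q₂ * s + r) =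
          (q₂ * (c * n) + q₁ * r) + q₁ * q₂ * s := by intro s; ring
      simp only [harg, Nat.cast_add, Nat.cast_mul, CharP.cast_eq_zero, zero_mul, zero_add]
      rw [← mul_sum, hκ, modQuad_linear_eq]
      simp only [G, Nat.cast_mul, hc, ZMod.natCast_val, ZMod.cast_id', id_eq]
      ring
    rw [sum_congr rfl hn, sum_add_distrib, ← mul_sum, ← mul_sum, hsum,
      sum_range_natCast_zmod (fun y ↦ χ₁⁻¹ y * G r (u * y)), sum_apply_mul_unit]
    ring
  rw [show q₁ * q₂ * c = q₁ * c * q₂ by ring, sum_range_mul_eq_sum_sum,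
    show q₁ * c * q₂ = q₁ * q₂ * c by ring]
  rw [sum_congr rfl fun r _ ↦ hmain r, ← mul_sum,
    sum_range_natCast_zmod (fun x ↦ χ₂⁻¹ x * ∑ y, χ₁⁻¹ y * G x y), twistedQuadSum]
  simp only [G, mul_sum, ← mul_assoc]

lemma gaussSum_stdAddChar_ne_zero {q : ℕ} [NeZero q] {χ : DirichletCharacter ℂ q}
    (hχ : χ.IsPrimitive) : gaussSum χ ZMod.stdAddChar ≠ 0 := by
  intro h
  have h₀ : ZMod.dft (χ : ZMod q → ℂ) = 0 := by
    ext k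
    rw [DirichletCharacter.fourierTransform_eq_gaussSum_mulShift,
      gaussSum_mulShift_of_isPrimitive _ hχ, h, mul_zero, Pi.zero_apply]
  rw [LinearEquiv.map_eq_zero_iff] at h₀
  simpa using congrFun h₀ 1

lemma sum_mul_stdAddChar {q : ℕ} [NeZero q] {χ : DirichletCharacter ℂ q}
    (hχ : χ.IsPrimitive) (a : ZMod q) :
    ∑ x, χ x * ZMod.stdAddChar (a * x) = χ⁻¹ a * gaussSum χ ZMod.stdAddChar := by
  rw [← gaussSum_mulShift_of_isPrimitive _ hχ]
  rfl

lemma two_mul_cos_eq_stdAddChar {q₁ q₂ : ℕ} [NeZero q₁] [NeZero q₂] (l : ℕ)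
    (x : ZMod q₂) (y : ZMod q₁) :
    2 * ((Real.cos (2 * Real.pi * l *
      ((((q₂ * y.val + q₁ * x.val) % (q₁ * q₂) : ℕ) : ℝ) / (q₁ * q₂))) : ℝ) : ℂ) =
    ZMod.stdAddChar ((l : ZMod q₂) * x) * ZMod.stdAddChar ((l : ZMod q₁) * y) +
      ZMod.stdAddChar (-(l : ZMod q₂) * x) * ZMod.stdAddChar (-(l : ZMod q₁) * y) := by
  have h₁ : (q₁ : ℝ) ≠ 0 := by exact_mod_cast NeZero.ne q₁
  have h₂ : (q₂ : ℝ) ≠ 0 := by exact_mod_cast NeZero.ne q₂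
  have h₁' : (q₁ : ℂ) ≠ 0 := by exact_mod_cast NeZero.ne q₁
  have h₂' : (q₂ : ℂ) ≠ 0 := by exact_mod_cast NeZero.ne q₂
  set k := (q₂ * y.val + q₁ * x.val) / (q₁ * q₂)
  have hmod : (((q₂ * y.val + q₁ * x.val) % (q₁ * q₂) : ℕ) : ℝ) =
      q₂ * y.val + q₁ * x.val - q₁ * q₂ * k := by
    have := Nat.mod_add_div (q₂ * y.val + q₁ * x.val) (q₁ * q₂)
    rw [eq_sub_iff_add_eq]
    exact_mod_cast this
  have hcos : Real.cos (2 * Real.pi * l *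
      ((((q₂ * y.val + q₁ * x.val) % (q₁ * q₂) : ℕ) : ℝ) / (q₁ * q₂))) =
      Real.cos (2 * Real.pi * l * (x.val / q₂ + y.val / q₁)) := by
    rw [← Real.cos_sub_nat_mul_two_pi (2 * Real.pi * l * (x.val / q₂ + y.val / q₁)) (l * k), hmod]
    congr 1
    push_cast
    field_simp
    ring
  have hx : ∀ m : ℤ, ZMod.stdAddChar ((m : ZMod q₂) * x) =
      Complex.exp (2 * Real.pi * Complex.I * (m * x.val) / q₂) := by
    intro m
    have := ZMod.stdAddChar_coe (N := q₂) (m * x.val)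
    simpa using this
  have hy : ∀ m : ℤ, ZMod.stdAddChar ((m : ZMod q₁) * y) =
      Complex.exp (2 * Real.pi * Complex.I * (m * y.val) / q₁) := by
    intro m
    have := ZMod.stdAddChar_coe (N := q₁) (m * y.val)
    simpa using this
  have hx₁ := hx l
  have hx₂ := hx (-l)
  have hy₁ := hy l
  have hy₂ := hy (-l)
  simp only [Int.cast_neg, Int.cast_natCast] at hx₁ hx₂ hy₁ hy₂
  rw [hcos, hx₁, hx₂, hy₁, hy₂, ← Complex.exp_add, ← Complex.exp_add, Complex.ofReal_cos,
    Complex.two_cos]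
  push_cast
  congr 2
  all_goals field_simp
  all_goals ring

lemma hasSum_cos_modQuad {D : ℕ} (hD : 0 < D) (m : ℕ) :
    HasSum (fun l : ℕ ↦ 1 / (l : ℂ) ^ 2 *
      ((Real.cos (2 * Real.pi * l * (((m % D : ℕ) : ℝ) / D)) : ℝ) : ℂ))
      (Real.pi ^ 2 * (modQuad D m / D ^ 2 + 1 / 6)) := by
  have hD' : (0 : ℝ) < D := by exact_mod_cast hD
  have hmem : ((m % D : ℕ) : ℝ) / D ∈ Set.Icc (0 : ℝ) 1 :=
    ⟨by positivity, (div_le_one hD').mpr (by exact_mod_cast (Nat.mod_lt m hD).le)⟩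
  have h := (Complex.hasSum_ofReal.mpr (hasSum_one_div_nat_pow_mul_cos one_ne_zero hmem))
  convert! h using 1
  · ext l; push_cast; ring
  · have hB : (Polynomial.map (algebraMap ℚ ℝ) (Polynomial.bernoulli (2 * 1))).eval
        (((m % D : ℕ) : ℝ) / D) = (((m % D : ℕ) : ℝ) / D) ^ 2 - ((m % D : ℕ) : ℝ) / D + 1 / 6 := by
      rw [Polynomial.bernoulli]
      simp [sum_range_succ, bernoulli, Polynomial.eval_add, Polynomial.map_add]
      ring
    rw [hB, modQuad]
    have : (D : ℂ) ≠ 0 := by exact_mod_cast hD.ne'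
    push_cast
    simp only [Nat.factorial]
    field_simp
    push_cast
    ring

lemma changeLevel_mul_changeLevel_apply {q₁ q₂ : ℕ} (χ₁ : DirichletCharacter ℂ q₁)
    (χ₂ : DirichletCharacter ℂ q₂) (l : ℕ) :
    (DirichletCharacter.changeLevel (Nat.dvd_mul_right q₁ q₂) χ₁ *
      DirichletCharacter.changeLevel (Nat.dvd_mul_left q₂ q₁) χ₂) (l : ZMod (q₁ * q₂)) =
    χ₁ l * χ₂ l := by
  by_cases hl : l.Coprime (q₁ * q₂)
  · have h : IsCoprime (l : ℤ) ((q₁ * q₂ : ℕ) : ℤ) := Nat.isCoprime_iff_coprime.mpr hl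
    have e₁ := DirichletCharacter.changeLevel_eq_cast_of_dvd' χ₁ (Nat.dvd_mul_right q₁ q₂) h
    have e₂ := DirichletCharacter.changeLevel_eq_cast_of_dvd' χ₂ (Nat.dvd_mul_left q₂ q₁) h
    simp only [Int.cast_natCast] at e₁ e₂
    rw [MulChar.mul_apply, e₁, e₂]
  · rw [MulChar.map_nonunit _ (by rwa [ZMod.isUnit_iff_coprime])]
    rw [Nat.coprime_mul_iff_right, not_and_or] at hl
    rcases hl with h | h
    · rw [MulChar.map_nonunit χ₁ (by rwa [ZMod.isUnit_iff_coprime]), zero_mul]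
    · rw [MulChar.map_nonunit χ₂ (by rwa [ZMod.isUnit_iff_coprime]), mul_zero]

lemma tsum_mul_div_sq_ne_zero {q₁ q₂ : ℕ} (χ₁ : DirichletCharacter ℂ q₁)
    (χ₂ : DirichletCharacter ℂ q₂) : ∑' l : ℕ, 1 / (l : ℂ) ^ 2 * (χ₁ l * χ₂ l) ≠ 0 := by
  have h := DirichletCharacter.LSeries_ne_zero_of_one_lt_re
    (DirichletCharacter.changeLevel (Nat.dvd_mul_right q₁ q₂) χ₁ *
      DirichletCharacter.changeLevel (Nat.dvd_mul_left q₂ q₁) χ₂) (s := 2) (by simp)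
  rw [LSeries] at h
  convert! h using 3 with l
  rcases eq_or_ne l 0 with rfl | hl
  · simp
  · rw [LSeries.term_of_ne_zero hl, changeLevel_mul_changeLevel_apply]
    norm_cast
    ring

lemma twistedQuadSum_inv_ne_zero {q₁ q₂ : ℕ} [NeZero q₁] [NeZero q₂] (hq₁ : 1 < q₁)
    {χ₁ : DirichletCharacter ℂ q₁} {χ₂ : DirichletCharacter ℂ q₂}
    (hχ₁ : χ₁.IsPrimitive) (hχ₂ : χ₂.IsPrimitive) (hpar : χ₁ (-1) * χ₂ (-1) = 1) :
    twistedQuadSum χ₁⁻¹ χ₂⁻¹ ≠ 0 := by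
  have hi₁ : χ₁⁻¹.IsPrimitive := by
    rwa [DirichletCharacter.isPrimitive_def, DirichletCharacter.conductor_inv]
  have hi₂ : χ₂⁻¹.IsPrimitive := by
    rwa [DirichletCharacter.isPrimitive_def, DirichletCharacter.conductor_inv]
  have hD : 0 < q₁ * q₂ := Nat.mul_pos (NeZero.pos q₁) (NeZero.pos q₂)
  set τ := gaussSum χ₁⁻¹ ZMod.stdAddChar * gaussSum χ₂⁻¹ ZMod.stdAddChar with hτ
  have hτ₀ : τ ≠ 0 :=
    mul_ne_zero (gaussSum_stdAddChar_ne_zero hi₁) (gaussSum_stdAddChar_ne_zero hi₂)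
  have hsum := hasSum_sum (s := univ) fun (x : ZMod q₂) _ ↦
    hasSum_sum (s := univ) fun (y : ZMod q₁) _ ↦
      (hasSum_cos_modQuad hD (q₂ * y.val + q₁ * x.val)).mul_left (χ₂⁻¹ x * χ₁⁻¹ y)
  have hsum₁ : ∑ y : ZMod q₁, χ₁⁻¹ y = 0 :=
    MulChar.sum_eq_zero_of_ne_one (inv_ne_one.mpr (ne_one_of_isPrimitive hq₁ hχ₁))
  have hval : ∑ x : ZMod q₂, ∑ y : ZMod q₁, χ₂⁻¹ x * χ₁⁻¹ y *
      (Real.pi ^ 2 * (modQuad (q₁ * q₂) (q₂ * y.val + q₁ * x.val) / ((q₁ * q₂ : ℕ) : ℂ) ^ 2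
        + 1 / 6)) =
      Real.pi ^ 2 / ((q₁ * q₂ : ℕ) : ℂ) ^ 2 * twistedQuadSum χ₁⁻¹ χ₂⁻¹ := by
    rw [twistedQuadSum, mul_sum]
    refine sum_congr rfl fun x _ ↦ ?_
    have : ∀ y : ZMod q₁, χ₂⁻¹ x * χ₁⁻¹ y *
      (Real.pi ^ 2 * (modQuad (q₁ * q₂) (q₂ * y.val + q₁ * x.val) / ((q₁ * q₂ : ℕ) : ℂ) ^ 2
        + 1 / 6)) = Real.pi ^ 2 / ((q₁ * q₂ : ℕ) : ℂ) ^ 2 *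
        (χ₂⁻¹ x * χ₁⁻¹ y * modQuad (q₁ * q₂) (q₂ * y.val + q₁ * x.val)) +
        χ₂⁻¹ x * Real.pi ^ 2 / 6 * χ₁⁻¹ y := fun y ↦ by ring
    simp only [this]
    rw [sum_add_distrib, ← mul_sum, ← mul_sum, hsum₁, mul_zero, add_zero]
  have hterm : ∀ l : ℕ, ∑ x : ZMod q₂, ∑ y : ZMod q₁, χ₂⁻¹ x * χ₁⁻¹ y * (1 / (l : ℂ) ^ 2 *
      ((Real.cos (2 * Real.pi * l *
        ((((q₂ * y.val + q₁ * x.val) % (q₁ * q₂) : ℕ) : ℝ) / ((q₁ * q₂ : ℕ) : ℝ))) : ℝ) : ℂ)) =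
      τ * (1 / (l : ℂ) ^ 2 * (χ₁ l * χ₂ l)) := by
    intro l
    have hxy : ∀ (x : ZMod q₂) (y : ZMod q₁), χ₂⁻¹ x * χ₁⁻¹ y * (1 / (l : ℂ) ^ 2 *
      ((Real.cos (2 * Real.pi * l *
        ((((q₂ * y.val + q₁ * x.val) % (q₁ * q₂) : ℕ) : ℝ) / ((q₁ * q₂ : ℕ) : ℝ))) : ℝ) : ℂ)) =
      1 / (2 * (l : ℂ) ^ 2) *
        ((χ₂⁻¹ x * ZMod.stdAddChar ((l : ZMod q₂) * x)) *
          (χ₁⁻¹ y * ZMod.stdAddChar ((l : ZMod q₁) * y)) +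
        (χ₂⁻¹ x * ZMod.stdAddChar (-(l : ZMod q₂) * x)) *
          (χ₁⁻¹ y * ZMod.stdAddChar (-(l : ZMod q₁) * y))) := by
      intro x y
      have := two_mul_cos_eq_stdAddChar l x y
      rw [Nat.cast_mul q₁ q₂]
      linear_combination (χ₂⁻¹ x * χ₁⁻¹ y * (1 / (2 * (l : ℂ) ^ 2))) * this
    have hneg₁ : χ₁ (-(l : ZMod q₁)) = χ₁ (-1) * χ₁ l := by rw [← map_mul, neg_one_mul]
    have hneg₂ : χ₂ (-(l : ZMod q₂)) = χ₂ (-1) * χ₂ l := by rw [← map_mul, neg_one_mul]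
    simp only [hxy, ← mul_sum, sum_add_distrib, ← sum_mul, sum_mul_stdAddChar hi₁,
      sum_mul_stdAddChar hi₂, inv_inv, hneg₁, hneg₂]
    rw [hτ]
    linear_combination (1 / (2 * (l : ℂ) ^ 2) * (χ₁ l * χ₂ l) *
      (gaussSum χ₁⁻¹ ZMod.stdAddChar * gaussSum χ₂⁻¹ ZMod.stdAddChar)) * hpar
  rw [hval] at hsum
  simp only [hterm] at hsum
  intro h
  rw [h, mul_zero] at hsum
  have := hsum.tsum_eq
  rw [tsum_mul_left] at this
  exact mul_ne_zero hτ₀ (tsum_mul_div_sq_ne_zero χ₁ χ₂) this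

lemma exists_rat_sawtooth (x : ℚ) : ∃ y : ℚ, sawtooth x = y := by
  unfold sawtooth
  split_ifs
  · exact ⟨0, by simp⟩
  · exact ⟨x - ⌊x⌋ - 1 / 2, by push_cast; rw [Rat.floor_cast]⟩

lemma newformDedekindSum_mem_Ffield {q₁ q₂ : ℕ} (χ₁ : DirichletCharacter ℂ q₁)
    (χ₂ : DirichletCharacter ℂ q₂) (h k : ℤ) : newformDedekindSum χ₁ χ₂ h k ∈ Ffield χ₁ χ₂ := by
  have hsaw : ∀ x : ℚ, ((sawtooth x : ℝ) : ℂ) ∈ Ffield χ₁ χ₂ := by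
    intro x
    obtain ⟨y, hy⟩ := exists_rat_sawtooth x
    rw [hy, Complex.ofReal_ratCast]
    exact SubfieldClass.ratCast_mem _ y
  have h₁ : ∀ x, (starRingEnd ℂ) (χ₁ x) ∈ Ffield χ₁ χ₂ := by
    intro x
    rw [show (starRingEnd ℂ) (χ₁ x) = χ₁⁻¹ x from MulChar.star_apply' χ₁ x,
      MulChar.inv_apply_eq_inv']
    exact inv_mem (Subfield.subset_closure (Or.inl ⟨x, rfl⟩))
  have h₂ : ∀ x, (starRingEnd ℂ) (χ₂ x) ∈ Ffield χ₁ χ₂ := by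
    intro x
    rw [show (starRingEnd ℂ) (χ₂ x) = χ₂⁻¹ x from MulChar.star_apply' χ₂ x,
      MulChar.inv_apply_eq_inv']
    exact inv_mem (Subfield.subset_closure (Or.inr ⟨x, rfl⟩))
  refine sum_mem fun j _ ↦ sum_mem fun n _ ↦ ?_
  refine mul_mem (mul_mem (mul_mem (h₂ _) (h₁ _)) ?_) ?_
  · simpa using hsaw ((j : ℚ) / k)
  · simpa using hsaw ((n : ℚ) / q₁ + h * j / k)

lemma SGamma_mem_Ffield {q₁ q₂ : ℕ} (χ₁ : DirichletCharacter ℂ q₁)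
    (χ₂ : DirichletCharacter ℂ q₂) (γ : Matrix.SpecialLinearGroup (Fin 2) ℤ) :
    SGamma χ₁ χ₂ γ ∈ Ffield χ₁ χ₂ := by
  unfold SGamma
  split_ifs
  · exact newformDedekindSum_mem_Ffield χ₁ χ₂ _ _
  · exact newformDedekindSum_mem_Ffield χ₁ χ₂ _ _
  · exact zero_mem _

/-- The Dedekind sums at `(1 + a b, b²)` are values of `SGamma` on parabolic matrices. -/
lemma newformDedekindSum_mem_image {q₁ q₂ : ℕ} (χ₁ : DirichletCharacter ℂ q₁)
    (χ₂ : DirichletCharacter ℂ q₂) (a : ℕ) {b : ℕ} (hb : 0 < b) (hbq : q₁ * q₂ ∣ b) :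
    newformDedekindSum χ₁ χ₂ (1 + a * b) (b ^ 2) ∈ SGamma χ₁ χ₂ ''
      (CongruenceSubgroup.Gamma0 (q₁ * q₂) : Set (Matrix.SpecialLinearGroup (Fin 2) ℤ)) := by
  have hdet : Matrix.det !![1 + (a : ℤ) * b, -(a : ℤ) ^ 2; (b : ℤ) ^ 2, 1 - a * b] = 1 := by
    rw [Matrix.det_fin_two_of]; ring
  refine ⟨⟨_, hdet⟩, ?_, ?_⟩
  · have h0 : (b : ZMod (q₁ * q₂)) = 0 := (ZMod.natCast_eq_zero_iff _ _).mpr hbq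
    refine CongruenceSubgroup.Gamma0_mem.mpr ?_
    simp [h0]
  · simp [SGamma, hb]

/-- The smallest subfield of `ℂ` containing all the values `S_{χ₁,χ₂}(γ)` for
`γ ∈ Γ₀(q₁q₂)` is exactly `F_{χ₁,χ₂}`, the smallest subfield of `ℂ` containing all
values of `χ₁` and `χ₂`. -/
theorem field_of_values_eq_Ffield {q₁ q₂ : ℕ} (hq₁ : 1 < q₁) (hq₂ : 1 < q₂)
    (χ₁ : DirichletCharacter ℂ q₁) (χ₂ : DirichletCharacter ℂ q₂)
    (hχ₁ : DirichletCharacter.IsPrimitive χ₁) (hχ₂ : DirichletCharacter.IsPrimitive χ₂)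
    (hpar : χ₁ (-1) * χ₂ (-1) = 1) :
    Subfield.closure (SGamma χ₁ χ₂ ''
        (CongruenceSubgroup.Gamma0 (q₁ * q₂) : Set (Matrix.SpecialLinearGroup (Fin 2) ℤ))) =
      Ffield χ₁ χ₂ := by
  have : NeZero q₁ := ⟨by omega⟩
  have : NeZero q₂ := ⟨by omega⟩
  have : Fact (1 < q₁) := ⟨hq₁⟩
  have hD : 0 < q₁ * q₂ := Nat.mul_pos (NeZero.pos q₁) (NeZero.pos q₂)
  apply le_antisymm
  · rw [Subfield.closure_le]
    rintro _ ⟨γ, -, rfl⟩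
    exact SGamma_mem_Ffield χ₁ χ₂ γ
  set K := Subfield.closure (SGamma χ₁ χ₂ ''
    (CongruenceSubgroup.Gamma0 (q₁ * q₂) : Set (Matrix.SpecialLinearGroup (Fin 2) ℤ))) with hK
  set M := twistedQuadSum χ₁⁻¹ χ₂⁻¹ with hM
  have hM₀ : M ≠ 0 := twistedQuadSum_inv_ne_zero hq₁ hχ₁ hχ₂ hpar
  have hq₁C : (q₁ : ℂ) ≠ 0 := by exact_mod_cast NeZero.ne q₁
  have hmem : ∀ (a : ℕ) {b : ℕ}, 0 < b → q₁ * q₂ ∣ b →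
      2 * b * newformDedekindSum χ₁ χ₂ (1 + a * b) (b ^ 2) ∈ K := fun a b hb hbq ↦
    mul_mem (mul_mem (ofNat_mem K 2) (natCast_mem K b))
      (Subfield.subset_closure (newformDedekindSum_mem_image χ₁ χ₂ a hb hbq))
  have hcancel : ∀ {c z : ℂ}, c ∈ K → c ≠ 0 → c * z ∈ K → z ∈ K := fun {c z} hc hc₀ hz ↦ by
    simpa [hc₀] using mul_mem (inv_mem hc) hz
  have hnum : ∀ u : (ZMod q₂)ˣ, χ₂ u * M ∈ K := by
    intro u
    have h := hmem (q₁ * (u : ZMod q₂).val) hD dvd_rfl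
    rw [newformDedekindSum_parabolic hq₁ hq₂ χ₁ χ₂ hχ₁ _ hD (mul_comm q₁ q₂)
      (Nat.dvd_mul_left q₂ q₁), sum_modQuad_numerator, mul_assoc] at h
    exact hcancel (natCast_mem K q₁) hq₁C h
  have hMK : M ∈ K := by simpa using hnum 1
  have hden : ∀ u : (ZMod q₁)ˣ, χ₁ u * M ∈ K := by
    intro u
    have hc : 0 < (u : ZMod q₁).val := by
      rw [ZMod.val_pos]
      exact u.ne_zero
    have h := hmem q₁ (Nat.mul_pos hD hc) (Nat.dvd_mul_right _ _)
    rw [newformDedekindSum_parabolic (d := q₂ * (u : ZMod q₁).val) hq₁ hq₂ χ₁ χ₂ hχ₁ _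
      (Nat.mul_pos hD hc) (by ring) ((Nat.dvd_mul_left q₂ q₁).mul_right _),
      sum_modQuad_denominator hq₁ χ₁ χ₂ hχ₁, mul_assoc] at h
    exact hcancel (mul_mem (natCast_mem K q₁) (natCast_mem K _))
      (mul_ne_zero hq₁C (by exact_mod_cast hc.ne')) h
  have hdiv : ∀ {z : ℂ}, z * M ∈ K → z ∈ K := fun hz ↦
    hcancel hMK hM₀ (by rwa [mul_comm])
  rw [Ffield, Subfield.closure_le]
  rintro _ (⟨x, rfl⟩ | ⟨x, rfl⟩)
  · by_cases hx : IsUnit x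
    · exact hdiv (hden hx.unit)
    · rw [MulChar.map_nonunit _ hx]; exact zero_mem K
  · by_cases hx : IsUnit x
    · exact hdiv (hnum hx.unit)
    · rw [MulChar.map_nonunit _ hx]; exact zero_mem K
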